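/- (Corollary 4.5 of the paper) Let 𝑴 be a real symmetric positive definite M×M matrix with unique symmetric positive definite square root 𝑴^{1/2} and 𝑴^{−1/2} = (𝑴^{1/2})^{−1}, let 𝒜 be a real symmetric positive definite M×M matrix, let U₀, F ∈ ℝ^M, let ε ∈ (0, 1/2) and K > 0. Then there exists a constant C > 0, depending only on 𝑴, 𝒜, U₀, F, ε and K (in particular independent of n and τ), such that the following holds for every integer n ≥ 1 and every τ ∈ (0,1) with max{τ‖𝒜‖₂, ‖I − τ𝒜‖₂} < 1, nτ ≤ 1, and n ≤ K τ^{−1/2 + ε}: let (U_k) be defined by U_0 = U₀ and U_k = 𝑴^{−1/2}(I + τ𝒜)^{−1}𝑴^{1/2}U_{k−1} + τ𝑴^{−1/2}(I + τ𝒜)^{−1}𝑴^{−1/2}F, let U be the M×(n+1) matrix with columns U_0, …, U_n, let X = UᵀU with eigenvalues λ_0(X) ≥ λ_1(X) ≥ ⋯ ≥ λ_n(X) in decreasing order, and let X̄* = Ū*ᵀŪ* where Ū* has columns Ū*_k = (1 − τ‖𝒜‖₂)^k U₀, with largest eigenvalue λ_0(X̄*). Then (λ_0(X) − λ_0(X̄*))²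 + Σ_{k=1}^{n} λ_k(X)² ≤ C τ^{4ε}. -/

import Mathlib

open Matrix Finset

/-- The spectral norm (operator 2-norm) of a real square matrix. -/
noncomputable def spec {M : ℕ} (A : Matrix (Fin M) (Fin M) ℝ) : ℝ :=
  ‖LinearMap.toContinuousLinearMap (Matrix.toEuclideanLin A)‖

/-- The squared Frobenius norm of a real matrix. -/
noncomputable def frobSq {m l : ℕ} (A : Matrix (Fin m) (Fin l) ℝ) : ℝ :=
  ∑ i, ∑ j, (A i j) ^ 2

/-- The squared Euclidean norm of a real vector. -/
noncomputable def vecNormSq {M : ℕ} (x : Fin M → ℝ) : ℝ := ∑ i, (x i) ^ 2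

/-- The Euclidean norm of a real vector. -/
noncomputable def vecNorm {M : ℕ} (x : Fin M → ℝ) : ℝ := Real.sqrt (∑ i, (x i) ^ 2)

/-- The M×(n+1) matrix whose columns are the vectors `v 0, …, v n`. -/
noncomputable def colMat {M n : ℕ} (v : Fin (n + 1) → Fin M → ℝ) :
    Matrix (Fin M) (Fin (n + 1)) ℝ :=
  Matrix.of fun i k => v k i

namespace Matrix.IsHermitian

variable {n : Type*} [Fintype n] [DecidableEq n] {X : Matrix n n ℝ}

theorem eq_mul_diagonal_eigenvalues_mul (hX : X.IsHermitian) :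
    X = (hX.eigenvectorUnitary : Matrix n n ℝ) * diagonal hX.eigenvalues *
      star (hX.eigenvectorUnitary : Matrix n n ℝ) := by
  conv_lhs => rw [hX.spectral_theorem, Unitary.conjStarAlgAut_apply]
  rfl

theorem sum_sq_eq_sum_eigenvalues_sq (hX : X.IsHermitian) :
    ∑ i, ∑ j, X i j ^ 2 = ∑ i, hX.eigenvalues i ^ 2 := by
  have h1 : ∑ i, ∑ j, X i j ^ 2 = (X * X).trace := by
    simp only [trace, diag_apply, mul_apply]
    refine Finset.sum_congr rfl fun i _ => Finset.sum_congr rfl fun j _ => ?_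
    rw [show X j i = X i j by simpa using hX.apply i j, sq]
  have h2 : X * X = (hX.eigenvectorUnitary : Matrix n n ℝ) *
      diagonal (fun i => hX.eigenvalues i * hX.eigenvalues i) *
      star (hX.eigenvectorUnitary : Matrix n n ℝ) := by
    conv_lhs => rw [hX.eq_mul_diagonal_eigenvalues_mul]
    rw [← diagonal_mul_diagonal]
    simp only [Matrix.mul_assoc]
    rw [← Matrix.mul_assoc (star _) _ (_ * _), Unitary.coe_star_mul_self, Matrix.one_mul]
  rw [h1, h2, trace_mul_comm, ← Matrix.mul_assoc, Unitary.coe_star_mul_self, Matrix.one_mul,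
    trace_diagonal]
  simp only [sq]

theorem dotProduct_mulVec_le (hX : X.IsHermitian) {b : ℝ} (hb : ∀ i, hX.eigenvalues i ≤ b)
    (v : n → ℝ) : v ⬝ᵥ X *ᵥ v ≤ b * (v ⬝ᵥ v) := by
  set Q : Matrix n n ℝ := (hX.eigenvectorUnitary : Matrix n n ℝ) with hQ
  have hQQ : Q * star Q = 1 := Unitary.coe_mul_star_self _
  have hadj (w : n → ℝ) : v ⬝ᵥ Q *ᵥ w = (star Q *ᵥ v) ⬝ᵥ w := by
    rw [dotProduct_mulVec, star_eq_conjTranspose, conjTranspose_eq_transpose_of_trivial,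
      mulVec_transpose]
  have h1 : v ⬝ᵥ X *ᵥ v = (star Q *ᵥ v) ⬝ᵥ diagonal hX.eigenvalues *ᵥ (star Q *ᵥ v) := by
    conv_lhs => rw [hX.eq_mul_diagonal_eigenvalues_mul, ← hQ]
    rw [← mulVec_mulVec, ← mulVec_mulVec, hadj]
  have h2 : v ⬝ᵥ v = (star Q *ᵥ v) ⬝ᵥ (star Q *ᵥ v) := by
    rw [← hadj, mulVec_mulVec, hQQ, one_mulVec]
  rw [h1, h2]
  simp only [dotProduct, mulVec_diagonal, Finset.mul_sum]
  refine Finset.sum_le_sum fun i _ => ?_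
  nlinarith [mul_le_mul_of_nonneg_right (hb i) (mul_self_nonneg ((star Q *ᵥ v) i))]

end Matrix.IsHermitian

/-- A Hoffman–Wielandt inequality for a perturbation of a rank-one positive semidefinite matrix. -/
theorem sq_sub_add_sum_sq_eigenvalues_le {n : ℕ} {X Y : Matrix (Fin (n + 1)) (Fin (n + 1)) ℝ}
    (hX : X.IsHermitian) (hY : Y.IsHermitian) (v : Fin (n + 1) → ℝ)
    (hv : ∀ i j, Y i j = v i * v j) (μ ν : Fin (n + 1) → ℝ) (σ σ' : Equiv.Perm (Fin (n + 1)))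
    (hμ : μ = hX.eigenvalues ∘ σ) (hμ' : Antitone μ)
    (hν : ν = hY.eigenvalues ∘ σ') (hν' : Antitone ν) :
    (μ 0 - ν 0) ^ 2 + ∑ k ∈ Finset.univ.erase (0 : Fin (n + 1)), μ k ^ 2 ≤
      ∑ i, ∑ j, (X i j - Y i j) ^ 2 := by
  have hYv : Y = vecMulVec v (star v) := by
    ext i j
    simp [vecMulVec_apply, hv]
  have hYpos : Y.PosSemidef := hYv ▸ posSemidef_vecMulVec_self_star v
  have hν0 (i) : 0 ≤ ν i := by
    rw [hν]
    exact hYpos.eigenvalues_nonneg _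
  have hsumν : ∑ i, ν i = v ⬝ᵥ v := by
    have h1 : ∑ i, ν i = Y.trace := by
      rw [hY.trace_eq_sum_eigenvalues, hν]
      exact Equiv.sum_comp σ' _
    rw [h1]
    simp [trace, dotProduct, hv]
  have hsumν2 : ∑ i, ν i ^ 2 = (v ⬝ᵥ v) ^ 2 := by
    have h1 : ∑ i, ν i ^ 2 = ∑ i, ∑ j, Y i j ^ 2 := by
      rw [hY.sum_sq_eq_sum_eigenvalues_sq, hν]
      exact Equiv.sum_comp σ' fun i => hY.eigenvalues i ^ 2
    rw [h1, sq, dotProduct, Finset.sum_mul_sum]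
    refine Finset.sum_congr rfl fun i _ => Finset.sum_congr rfl fun j _ => ?_
    rw [hv]
    ring
  have hsumμ2 : ∑ i, μ i ^ 2 = ∑ i, ∑ j, X i j ^ 2 := by
    rw [hX.sum_sq_eq_sum_eigenvalues_sq, hμ]
    exact Equiv.sum_comp σ fun i => hX.eigenvalues i ^ 2
  have hνtop : ν 0 = v ⬝ᵥ v := by
    have hle : ν 0 ≤ v ⬝ᵥ v := by
      rw [← hsumν]
      exact Finset.single_le_sum (fun i _ => hν0 i) (Finset.mem_univ 0)
    refine le_antisymm hle ?_
    have h2 : (v ⬝ᵥ v) ^ 2 ≤ ν 0 * (v ⬝ᵥ v) := by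
      rw [← hsumν2, ← hsumν, Finset.mul_sum]
      refine Finset.sum_le_sum fun i _ => ?_
      rw [sq]
      exact mul_le_mul_of_nonneg_right (hν' (Fin.zero_le i)) (hν0 i)
    by_contra! hlt
    nlinarith [hν0 0]
  have hcross : ∑ i, ∑ j, X i j * Y i j ≤ μ 0 * ν 0 := by
    have hb (i) : hX.eigenvalues i ≤ μ 0 := by
      have := hμ' (Fin.zero_le (σ.symm i))
      simpa [hμ] using this
    rw [hνtop]
    refine le_trans (le_of_eq ?_) (hX.dotProduct_mulVec_le hb v)
    simp only [dotProduct, mulVec, Finset.mul_sum, hv]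
    exact Finset.sum_congr rfl fun i _ => Finset.sum_congr rfl fun j _ => by ring
  have hexp : ∑ i, ∑ j, (X i j - Y i j) ^ 2 =
      ∑ i, ∑ j, X i j ^ 2 - 2 * ∑ i, ∑ j, X i j * Y i j + ∑ i, ∑ j, Y i j ^ 2 := by
    simp only [Finset.mul_sum, ← Finset.sum_sub_distrib, ← Finset.sum_add_distrib]
    exact Finset.sum_congr rfl fun i _ => Finset.sum_congr rfl fun j _ => by ring
  have hYsq : ∑ i, ∑ j, Y i j ^ 2 = ν 0 ^ 2 := by
    rw [hνtop, ← hsumν2, hY.sum_sq_eq_sum_eigenvalues_sq, hν]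
    exact (Equiv.sum_comp σ' fun i => hY.eigenvalues i ^ 2).symm
  have hsplit := Finset.add_sum_erase Finset.univ (fun i => μ i ^ 2) (Finset.mem_univ 0)
  rw [hexp, hYsq, ← hsumμ2, ← hsplit]
  nlinarith

section BackwardEuler

variable {E : Type*} [NormedAddCommGroup E] [InnerProductSpace ℝ E]

theorem norm_le_norm_add_smul_of_inner_nonneg (T : E →ₗ[ℝ] E)
    (hT : ∀ x, 0 ≤ inner ℝ x (T x)) {τ : ℝ} (hτ : 0 ≤ τ) (x : E) :
    ‖x‖ ≤ ‖x + τ • T x‖ := by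
  have h1 : ‖x‖ * ‖x‖ ≤ ‖x‖ * ‖x + τ • T x‖ := by
    refine le_trans ?_ (real_inner_le_norm x (x + τ • T x))
    rw [inner_add_right, real_inner_smul_right, real_inner_self_eq_norm_mul_norm]
    nlinarith [mul_nonneg hτ (hT x)]
  rcases (norm_nonneg x).eq_or_lt with h | h
  · rw [← h]
    exact norm_nonneg _
  · exact le_of_mul_le_mul_left h1 h

theorem norm_backwardEuler_le (T : E →ₗ[ℝ] E) (hT : ∀ x, 0 ≤ inner ℝ x (T x)) {τ : ℝ}
    (hτ : 0 ≤ τ) (d : ℕ → E) (c : E) (h0 : d 0 = 0)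
    (hd : ∀ k, d (k + 1) + τ • T (d (k + 1)) = d k + τ • c) (k : ℕ) :
    ‖d k‖ ≤ k * τ * ‖c‖ := by
  induction k with
  | zero => simp [h0]
  | succ k ih =>
    calc ‖d (k + 1)‖ ≤ ‖d (k + 1) + τ • T (d (k + 1))‖ :=
          norm_le_norm_add_smul_of_inner_nonneg T hT hτ _
      _ ≤ ‖d k‖ + ‖τ • c‖ := by rw [hd]; exact norm_add_le _ _
      _ ≤ k * τ * ‖c‖ + τ * ‖c‖ := by
          rw [norm_smul, Real.norm_of_nonneg hτ]
          gcongr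
      _ = ((k + 1 : ℕ) : ℝ) * τ * ‖c‖ := by push_cast; ring

theorem abs_inner_sub_inner_le (u u' b b' : E) {δ B : ℝ} (hu : ‖u'‖ ≤ B)
    (hb : ‖b‖ ≤ B) (h : ‖u - b‖ ≤ δ) (h' : ‖u' - b'‖ ≤ δ) :
    |inner ℝ u u' - inner ℝ b b'| ≤ 2 * B * δ := by
  have h1 : inner ℝ u u' - inner ℝ b b' = inner ℝ (u - b) u' + inner ℝ b (u' - b') := by
    rw [inner_sub_left, inner_sub_right]
    ring
  have h2 := abs_real_inner_le_norm (u - b) u'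
  have h3 := abs_real_inner_le_norm b (u' - b')
  have h4 : ‖u - b‖ * ‖u'‖ ≤ δ * B :=
    mul_le_mul h hu (norm_nonneg _) ((norm_nonneg _).trans h)
  have h5 : ‖b‖ * ‖u' - b'‖ ≤ B * δ :=
    mul_le_mul hb h' (norm_nonneg _) ((norm_nonneg _).trans hb)
  rw [h1]
  linarith [abs_add_le (inner ℝ (u - b) u') (inner ℝ b (u' - b'))]

end BackwardEuler

theorem exists_norm_iterate_sub_le {M : ℕ} (S A : Matrix (Fin M) (Fin M) ℝ)
    (hS : S.PosDef) (hA : A.PosDef) (U₀ F : Fin M → ℝ) :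
    ∃ c : ℝ, 0 ≤ c ∧ ∀ τ : ℝ, 0 < τ → ∀ U : ℕ → Fin M → ℝ, U 0 = U₀ →
      (∀ k : ℕ, 1 ≤ k → U k = (S⁻¹ * (1 + τ • A)⁻¹ * S).mulVec (U (k - 1)) +
        τ • (S⁻¹ * (1 + τ • A)⁻¹ * S⁻¹).mulVec F) →
      ∀ k : ℕ, ‖WithLp.toLp 2 (U k) - WithLp.toLp 2 U₀‖ ≤ c * (k * τ) := by
  set R := LinearMap.toContinuousLinearMap (Matrix.toEuclideanLin S⁻¹)
  set c : EuclideanSpace ℝ (Fin M) := WithLp.toLp 2 (S⁻¹ *ᵥ F - A *ᵥ S *ᵥ U₀) with hc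
  refine ⟨‖R‖ * ‖c‖, by positivity, fun τ hτ U hU0 hU k => ?_⟩
  have hSdet : IsUnit S.det := (Matrix.isUnit_iff_isUnit_det S).1 hS.isUnit
  have hBdet : IsUnit (1 + τ • A).det :=
    (Matrix.isUnit_iff_isUnit_det _).1 (Matrix.PosDef.one.add (hA.smul hτ)).isUnit
  have hstep (k : ℕ) : (1 + τ • A) *ᵥ S *ᵥ U (k + 1) = S *ᵥ U k + τ • S⁻¹ *ᵥ F := by
    rw [hU (k + 1) (by omega), Nat.add_sub_cancel, mulVec_add, mulVec_add, mulVec_smul,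
      mulVec_smul]
    simp only [mulVec_mulVec]
    simp only [Matrix.mul_assoc, Matrix.mul_nonsing_inv_cancel_left _ _ hSdet,
      Matrix.mul_nonsing_inv_cancel_left _ _ hBdet]
  have hd := norm_backwardEuler_le (Matrix.toEuclideanLin A)
    (fun x => by
      rw [EuclideanSpace.inner_eq_star_dotProduct, dotProduct_comm]
      simpa using hA.posSemidef.dotProduct_mulVec_nonneg (WithLp.ofLp x))
    hτ.le (fun k => WithLp.toLp 2 (S *ᵥ U k - S *ᵥ U₀)) c (by simp [hU0])
    (fun k => by
      rw [hc]
      simp only [Matrix.toLpLin_toLp, ← WithLp.toLp_smul, ← WithLp.toLp_add]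
      congr 1
      have := hstep k
      rw [add_mulVec, one_mulVec, smul_mulVec] at this
      simp only [toLin'_apply, mulVec_sub, smul_sub]
      linear_combination this) k
  have hR : WithLp.toLp 2 (U k) - WithLp.toLp 2 U₀ =
      R (WithLp.toLp 2 (S *ᵥ U k - S *ᵥ U₀)) := by
    change _ = Matrix.toEuclideanLin S⁻¹ _
    rw [Matrix.toLpLin_toLp, toLin'_apply, ← mulVec_sub, mulVec_mulVec,
      Matrix.nonsing_inv_mul _ hSdet, one_mulVec, WithLp.toLp_sub]
  rw [hR]
  calc _ ≤ ‖R‖ * ‖_‖ := R.le_opNorm _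
    _ ≤ ‖R‖ * (k * τ * ‖c‖) := by gcongr
    _ = _ := by ring

theorem sum_sum_sq_le {n : ℕ} (hn : 1 ≤ n) {τ ε K L : ℝ} (hτ : 0 < τ)
    (hK : (n : ℝ) ≤ K * τ ^ (-(1 / 2 : ℝ) + ε)) (Z : Fin (n + 1) → Fin (n + 1) → ℝ)
    (hZ : ∀ i j, |Z i j| ≤ L * (n * τ)) :
    ∑ i, ∑ j, Z i j ^ 2 ≤ 4 * L ^ 2 * K ^ 4 * τ ^ (4 * ε) := by
  have hn' : (1 : ℝ) ≤ n := by exact_mod_cast hn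
  have hpow : (τ ^ (-(1 / 2 : ℝ) + ε)) ^ 4 * τ ^ 2 = τ ^ (4 * ε) := by
    rw [← Real.rpow_natCast, ← Real.rpow_mul hτ.le, ← Real.rpow_natCast τ 2,
      ← Real.rpow_add hτ]
    congr 1
    push_cast
    ring
  calc ∑ i, ∑ j, Z i j ^ 2
      ≤ ∑ _i : Fin (n + 1), ∑ _j : Fin (n + 1), (L * (n * τ)) ^ 2 :=
        Finset.sum_le_sum fun i _ => Finset.sum_le_sum fun j _ =>
          sq_le_sq' (abs_le.1 (hZ i j)).1 (abs_le.1 (hZ i j)).2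
    _ = (n + 1 : ℝ) ^ 2 * (L * (n * τ)) ^ 2 := by
        simp
        ring
    _ ≤ (2 * n : ℝ) ^ 2 * (L * (n * τ)) ^ 2 := by
        gcongr
        linarith
    _ = 4 * L ^ 2 * (n : ℝ) ^ 4 * τ ^ 2 := by ring
    _ ≤ 4 * L ^ 2 * (K * τ ^ (-(1 / 2 : ℝ) + ε)) ^ 4 * τ ^ 2 := by gcongr
    _ = 4 * L ^ 2 * K ^ 4 * τ ^ (4 * ε) := by rw [← hpow]; ring

theorem gram_colMat_apply {M n : ℕ} (v : Fin (n + 1) → Fin M → ℝ) (i j : Fin (n + 1)) :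
    ((colMat v)ᵀ * colMat v) i j = inner ℝ (WithLp.toLp 2 (v i)) (WithLp.toLp 2 (v j)) := by
  simp [colMat, mul_apply, EuclideanSpace.inner_toLp_toLp, dotProduct, mul_comm]

/-- **Corollary 4.5.** Given `ε ∈ (0, 1/2)` and `K > 0`, there is a constant `C > 0`,
independent of `n` and `τ`, such that for all `n ≥ 1` and `τ ∈ (0,1)` with
`max{τ‖𝒜‖₂, ‖I - τ𝒜‖₂} < 1`, `nτ ≤ 1` and `n ≤ K τ^{-1/2+ε}`:
with `X = UᵀU` for the backward Euler iterates `U_k` (eigenvalues `μ` in decreasing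
order) and `X̄* = Ū*ᵀŪ*` for `Ū*_k = (1 - τ‖𝒜‖₂)^k U₀` (eigenvalues `ν` in decreasing
order), one has `(λ₀(X) - λ₀(X̄*))² + ∑_{k=1}^n λ_k(X)² ≤ C τ^{4ε}`. -/
theorem corollary_4_5 {M : ℕ} (Mmat Msq A : Matrix (Fin M) (Fin M) ℝ)
    (hM : Mmat.PosDef) (hMsq : Msq.PosDef) (hsq : Msq * Msq = Mmat)
    (hA : A.PosDef) (U₀ F : Fin M → ℝ)
    (ε : ℝ) (hε : 0 < ε) (hε' : ε < 1 / 2) (K : ℝ) (hK : 0 < K) :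
    ∃ C > 0, ∀ n : ℕ, 1 ≤ n → ∀ τ : ℝ, 0 < τ → τ < 1 →
      τ * spec A < 1 → spec (1 - τ • A) < 1 → (n : ℝ) * τ ≤ 1 →
      (n : ℝ) ≤ K * τ ^ (-(1 / 2 : ℝ) + ε) →
      ∀ U : ℕ → Fin M → ℝ, U 0 = U₀ →
        (∀ k : ℕ, 1 ≤ k → U k = (Msq⁻¹ * (1 + τ • A)⁻¹ * Msq).mulVec (U (k - 1)) +
          τ • (Msq⁻¹ * (1 + τ • A)⁻¹ * Msq⁻¹).mulVec F) →
        ∀ (hX : ((colMat fun k : Fin (n + 1) => U (k : ℕ))ᵀ *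
            (colMat fun k : Fin (n + 1) => U (k : ℕ))).IsHermitian)
          (hXbar : ((colMat fun k : Fin (n + 1) => (1 - τ * spec A) ^ (k : ℕ) • U₀)ᵀ *
            (colMat fun k : Fin (n + 1) => (1 - τ * spec A) ^ (k : ℕ) • U₀)).IsHermitian)
          (μ ν : Fin (n + 1) → ℝ)
          (σ σ' : Equiv.Perm (Fin (n + 1))),
          μ = hX.eigenvalues ∘ σ → Antitone μ →
          ν = hXbar.eigenvalues ∘ σ' → Antitone ν →
          (μ 0 - ν 0) ^ 2 + ∑ k ∈ Finset.univ.erase (0 : Fin (n + 1)), μ k ^ 2 ≤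
            C * τ ^ (4 * ε) := by
  obtain ⟨c, hc0, hc⟩ := exists_norm_iterate_sub_le Msq A hMsq hA U₀ F
  set u₀ : EuclideanSpace ℝ (Fin M) := WithLp.toLp 2 U₀ with hu₀
  have ha : 0 ≤ spec A := norm_nonneg _
  set L := 2 * (‖u₀‖ + c) * (c + spec A * ‖u₀‖) with hL
  refine ⟨4 * L ^ 2 * K ^ 4 + 1, by positivity,
    fun n hn τ hτ hτ1 hτA _ hnτ hnK U hU0 hU hX hXbar μ ν σ σ' hμ hμ' hν hν' => ?_⟩
  set r := 1 - τ * spec A with hr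
  have hr0 : 0 ≤ r := by linarith
  have hr1 : r ≤ 1 := by nlinarith
  refine (sq_sub_add_sum_sq_eigenvalues_le hX hXbar (fun k => r ^ (k : ℕ) * ‖u₀‖)
    (fun i j => ?_) μ ν σ σ' hμ hμ' hν hν').trans ?_
  · rw [gram_colMat_apply, WithLp.toLp_smul, WithLp.toLp_smul, real_inner_smul_left,
      real_inner_smul_right, real_inner_self_eq_norm_mul_norm]
    ring
  refine (sum_sum_sq_le (L := L) hn hτ hnK _ fun i j => ?_).trans ?_
  · have hk (k : Fin (n + 1)) : (k : ℝ) * τ ≤ n * τ := by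
      gcongr
      exact_mod_cast Nat.lt_succ_iff.1 k.2
    have hu (k : Fin (n + 1)) : ‖WithLp.toLp 2 (U k) - u₀‖ ≤ c * (n * τ) :=
      (hc τ hτ U hU0 hU k).trans (mul_le_mul_of_nonneg_left (hk k) hc0)
    have hb (k : Fin (n + 1)) : ‖WithLp.toLp 2 (r ^ (k : ℕ) • U₀) - u₀‖ ≤
        spec A * ‖u₀‖ * (n * τ) := by
      have h1 : 1 - (k : ℝ) * (τ * spec A) ≤ r ^ (k : ℕ) := by
        have := one_add_mul_le_pow (a := -(τ * spec A)) (by linarith) k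
        rw [← sub_eq_add_neg, ← hr] at this
        linarith
      have h2 : |r ^ (k : ℕ) - 1| ≤ spec A * (n * τ) := by
        rw [abs_le]
        have h3 := mul_le_mul_of_nonneg_left (hk k) ha
        have h4 := pow_le_one₀ hr0 hr1 (n := k)
        have h5 : 0 ≤ spec A * (n * τ) := by positivity
        constructor <;> linarith
      rw [WithLp.toLp_smul, ← hu₀, show r ^ (k : ℕ) • u₀ - u₀ = (r ^ (k : ℕ) - 1) • u₀ by
        rw [sub_smul, one_smul], norm_smul, Real.norm_eq_abs]
      nlinarith [mul_le_mul_of_nonneg_right h2 (norm_nonneg u₀)]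
    have hub (k : Fin (n + 1)) : ‖WithLp.toLp 2 (U k) - WithLp.toLp 2 (r ^ (k : ℕ) • U₀)‖ ≤
        (c + spec A * ‖u₀‖) * (n * τ) := by
      have h1 := norm_sub_le_norm_sub_add_norm_sub (WithLp.toLp 2 (U k)) u₀
        (WithLp.toLp 2 (r ^ (k : ℕ) • U₀))
      rw [norm_sub_rev u₀] at h1
      linarith [hu k, hb k]
    have hun (k : Fin (n + 1)) : ‖WithLp.toLp 2 (U k)‖ ≤ ‖u₀‖ + c := by
      have h1 := norm_sub_norm_le (WithLp.toLp 2 (U k)) u₀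
      nlinarith [hu k]
    have hbn (k : Fin (n + 1)) : ‖WithLp.toLp 2 (r ^ (k : ℕ) • U₀)‖ ≤ ‖u₀‖ + c := by
      rw [WithLp.toLp_smul, ← hu₀, norm_smul, Real.norm_of_nonneg (pow_nonneg hr0 _)]
      nlinarith [pow_le_one₀ hr0 hr1 (n := k), norm_nonneg u₀]
    rw [gram_colMat_apply, gram_colMat_apply]
    refine (abs_inner_sub_inner_le _ _ _ _ (hun j) (hbn i) (hub i) (hub j)).trans
      (le_of_eq ?_)
    rw [hL]
    ring
  · have : 0 ≤ τ ^ (4 * ε) := Real.rpow_nonneg hτ.le _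
    linarith
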